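/- Every finite nonempty set S ⊆ ℤ satisfies d_p(S) ≥ 1/|diff(S)|. -/

import Mathlib

open Pointwise Filter

/-- The difference set of `S`: `{s - t : s, t ∈ S, s ≥ t}`. -/
def diffSet (S : Set ℤ) : Set ℤ := {d | ∃ s ∈ S, ∃ t ∈ S, t ≤ s ∧ d = s - t}

/-- `A` is `S`-packing if translates `S + a₁` and `S + a₂` are disjoint for distinct `a₁, a₂ ∈ A`. -/
def SPacking (S A : Set ℤ) : Prop :=
  ∀ a₁ ∈ A, ∀ a₂ ∈ A, a₁ ≠ a₂ →
    Disjoint ((fun s => s + a₁) '' S) ((fun s => s + a₂) '' S)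

/-- Upper density of `A ⊆ ℤ`. -/
noncomputable def upperDensity (A : Set ℤ) : ℝ :=
  limsup (fun n : ℕ => ((A ∩ Set.Icc (-(n : ℤ)) (n : ℤ)).ncard : ℝ) / (2 * n + 1)) atTop

/-- Lower density of `A ⊆ ℤ`. -/
noncomputable def lowerDensity (A : Set ℤ) : ℝ :=
  liminf (fun n : ℕ => ((A ∩ Set.Icc (-(n : ℤ)) (n : ℤ)).ncard : ℝ) / (2 * n + 1)) atTop

/-- Packing density of `S`: supremum of upper densities of `S`-packing sets. -/
noncomputable def packingDensity (S : Set ℤ) : ℝ :=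
  sSup {d : ℝ | ∃ A : Set ℤ, SPacking S A ∧ d = upperDensity A}

/-- `t`, `A` are the sequences produced by the greedy packing algorithm for `S`:
`A₋₁ = ∅`, and for `i ≥ 0`, `tᵢ = min {x : x ≥ 0, x ∉ Aᵢ₋₁ + diff S}` and `Aᵢ = Aᵢ₋₁ ∪ {tᵢ}`. -/
def GreedySeq (S : Set ℤ) (t : ℕ → ℤ) (A : ℕ → Set ℤ) : Prop :=
  IsLeast {x : ℤ | 0 ≤ x ∧ x ∉ (∅ : Set ℤ) + diffSet S} (t 0) ∧
  (∀ i : ℕ, IsLeast {x : ℤ | 0 ≤ x ∧ x ∉ A i + diffSet S} (t (i + 1))) ∧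
  A 0 = (∅ : Set ℤ) ∪ {t 0} ∧
  (∀ i : ℕ, A (i + 1) = A i ∪ {t (i + 1)})

/-- `A` is `a`-forward-periodic with period `p`. -/
def FwdPeriodic (A : Set ℤ) (a p : ℤ) : Prop :=
  ∀ i : ℤ, 0 ≤ i → ((a + i ∈ A) ↔ (a + i + p ∈ A))

/-- Interval density of `A` restricted to `[a, b-1]`. -/
noncomputable def intervalDensity (A : Set ℤ) (a b : ℤ) : ℝ :=
  ((A ∩ Set.Icc a (b - 1)).ncard : ℝ) / ((b : ℝ) - a)

/-- Membership in the set obtained by scanning `0, 1, 2, …` and keeping each `n` that does not lie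
in `m + D` for any `m` kept earlier. -/
def IsGreedy (D : Set ℤ) (n : ℕ) : Prop :=
  ∀ m, m < n → IsGreedy D m → ((n : ℤ) - m) ∉ D
termination_by n

theorem IsGreedy.sub_notMem {D : Set ℤ} {m n : ℕ} (hn : IsGreedy D n) (hm : IsGreedy D m)
    (h : m < n) : ((n : ℤ) - m) ∉ D := by
  rw [IsGreedy] at hn
  exact hn m h hm

theorem exists_isGreedy_sub_mem {D : Set ℤ} (h0 : (0 : ℤ) ∈ D) (n : ℕ) :
    ∃ m, m ≤ n ∧ IsGreedy D m ∧ ((n : ℤ) - m) ∈ D := by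
  by_cases h : IsGreedy D n
  · exact ⟨n, le_rfl, h, by simpa using h0⟩
  · rw [IsGreedy] at h
    push Not at h
    obtain ⟨m, hm, hg, hd⟩ := h
    exact ⟨m, hm.le, hg, hd⟩

/-- The greedy set on the nonnegative integers together with its reflection `x ↦ -M - x`. -/
def reflectedGreedy (D : Set ℤ) (M : ℤ) : Set ℤ :=
  {x | ∃ n : ℕ, IsGreedy D n ∧ (x = n ∨ x = -M - n)}

theorem diffSet_finite {S : Set ℤ} (h : S.Finite) : (diffSet S).Finite := by
  refine (h.image2 (fun s t => s - t) h).subset ?_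
  rintro d ⟨s, hs, t, ht, -, rfl⟩
  exact ⟨s, hs, t, ht, rfl⟩

theorem zero_mem_diffSet {S : Set ℤ} (h : S.Nonempty) : (0 : ℤ) ∈ diffSet S := by
  obtain ⟨s, hs⟩ := h
  exact ⟨s, hs, s, hs, le_rfl, by simp⟩

theorem sPacking_of_sub_notMem_diffSet {S A : Set ℤ}
    (h : ∀ a ∈ A, ∀ b ∈ A, a < b → b - a ∉ diffSet S) : SPacking S A := by
  intro a ha b hb hab
  rw [Set.disjoint_left]
  rintro _ ⟨s, hs, rfl⟩ ⟨t, ht, hst⟩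
  dsimp only at hst
  rcases lt_or_gt_of_ne hab with hlt | hlt
  · exact h a ha b hb hlt ⟨s, hs, t, ht, by omega, by omega⟩
  · exact h b hb a ha hlt ⟨t, ht, s, hs, by omega, by omega⟩

theorem sPacking_reflectedGreedy {S : Set ℤ} {M : ℤ} (hM : ∀ d ∈ diffSet S, d < M) :
    SPacking S (reflectedGreedy (diffSet S) M) := by
  apply sPacking_of_sub_notMem_diffSet
  rintro a ⟨m, hm, rfl | rfl⟩ b ⟨n, hn, rfl | rfl⟩ hab hd
  · exact hn.sub_notMem hm (by omega) hd
  · have := hM _ hd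
    omega
  · have := hM _ hd
    omega
  · refine hm.sub_notMem hn (by omega) ?_
    convert hd using 1
    ring

theorem le_ncard_reflectedGreedy_mul {D : Set ℤ} (hD : D.Finite) (h0 : (0 : ℤ) ∈ D)
    {M : ℕ} (hM : 0 < M) (n : ℕ) :
    2 * n + 1 ≤
      (reflectedGreedy D M ∩ Set.Icc (-(n : ℤ)) (n : ℤ)).ncard * D.ncard + M := by
  set C := reflectedGreedy D M ∩ Set.Icc (-(n : ℤ)) (n : ℤ) with hC
  have hCf : C.Finite := (Set.finite_Icc _ _).subset Set.inter_subset_right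
  let f : ℤ × ℤ → ℤ := fun p => if 0 ≤ p.1 then p.1 + p.2 else p.1 - p.2
  have hsub : Set.Icc (-(n : ℤ)) (n : ℤ) ⊆ f '' (C ×ˢ D) ∪ Set.Ico (-(M : ℤ)) 0 := by
    rintro x ⟨hx₁, hx₂⟩
    by_cases hx : x ∈ Set.Ico (-(M : ℤ)) 0
    · exact Or.inr hx
    left
    rcases le_or_gt 0 x with hx0 | hx0
    · lift x to ℕ using hx0
      obtain ⟨m, hmx, hm, hd⟩ := exists_isGreedy_sub_mem h0 x
      refine ⟨((m : ℤ), (x : ℤ) - m), ⟨⟨⟨m, hm, Or.inl rfl⟩, ?_, ?_⟩, hd⟩, ?_⟩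
      · dsimp only
        omega
      · dsimp only
        omega
      · simp [f]
    · have hxM : x < -(M : ℤ) := by
        by_contra hcon
        exact hx ⟨by omega, hx0⟩
      obtain ⟨y, hy⟩ := Int.eq_ofNat_of_zero_le (show 0 ≤ -(M : ℤ) - x by omega)
      obtain ⟨m, hmy, hm, hd⟩ := exists_isGreedy_sub_mem h0 y
      refine ⟨(-(M : ℤ) - m, (y : ℤ) - m), ⟨⟨⟨m, hm, Or.inr rfl⟩, ?_, ?_⟩, hd⟩, ?_⟩
      · dsimp only
        omega
      · dsimp only
        omega
      · simp only [f]
        rw [if_neg (by omega)]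
        omega
  have hprod : (C ×ˢ D).Finite := hCf.prod hD
  calc 2 * n + 1 = (Set.Icc (-(n : ℤ)) (n : ℤ)).ncard := by
        rw [← Finset.coe_Icc, Set.ncard_coe_finset, Int.card_Icc]
        omega
    _ ≤ (f '' (C ×ˢ D) ∪ Set.Ico (-(M : ℤ)) 0).ncard :=
        Set.ncard_le_ncard hsub ((hprod.image f).union (Set.finite_Ico _ _))
    _ ≤ (f '' (C ×ˢ D)).ncard + (Set.Ico (-(M : ℤ)) 0).ncard := Set.ncard_union_le _ _
    _ ≤ C.ncard * D.ncard + M := by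
        gcongr
        · exact (Set.ncard_image_le hprod).trans_eq Set.ncard_prod
        · rw [← Finset.coe_Ico, Set.ncard_coe_finset, Int.card_Ico]
          omega

theorem ncard_inter_Icc_div_le_one (A : Set ℤ) (n : ℕ) :
    ((A ∩ Set.Icc (-(n : ℤ)) (n : ℤ)).ncard : ℝ) / (2 * n + 1) ≤ 1 := by
  rw [div_le_one (by positivity)]
  have h := Set.ncard_le_ncard (Set.inter_subset_right (s := A)) (Set.finite_Icc (-(n : ℤ)) n)
  rw [← Finset.coe_Icc, Set.ncard_coe_finset, Int.card_Icc] at h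
  have h' : (A ∩ (Finset.Icc (-(n : ℤ)) n : Finset ℤ)).ncard ≤ 2 * n + 1 := by omega
  rw [← Finset.coe_Icc]
  exact_mod_cast h'

theorem upperDensity_le_one (A : Set ℤ) : upperDensity A ≤ 1 := by
  refine limsup_le_of_le ?_ (Eventually.of_forall (ncard_inter_Icc_div_le_one A))
  exact IsBoundedUnder.isCoboundedUnder_le
    (isBoundedUnder_of ⟨0, fun n => by positivity⟩)

theorem le_upperDensity_of_tendsto {A : Set ℤ} {v : ℕ → ℝ} {c : ℝ}
    (hv : Tendsto v atTop (nhds c))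
    (h : ∀ n : ℕ, v n ≤ ((A ∩ Set.Icc (-(n : ℤ)) (n : ℤ)).ncard : ℝ) / (2 * n + 1)) :
    c ≤ upperDensity A := by
  rw [← hv.limsup_eq]
  exact limsup_le_limsup (Eventually.of_forall h) hv.isBoundedUnder_ge.isCoboundedUnder_le
    (isBoundedUnder_of ⟨1, ncard_inter_Icc_div_le_one A⟩)

theorem upperDensity_le_packingDensity {S A : Set ℤ} (h : SPacking S A) :
    upperDensity A ≤ packingDensity S := by
  refine le_csSup ⟨1, ?_⟩ ⟨A, h, rfl⟩
  rintro _ ⟨B, -, rfl⟩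
  exact upperDensity_le_one B

theorem one_div_ncard_le_upperDensity_reflectedGreedy {D : Set ℤ} (hD : D.Finite)
    (h0 : (0 : ℤ) ∈ D) {M : ℕ} (hM : 0 < M) :
    1 / (D.ncard : ℝ) ≤ upperDensity (reflectedGreedy D M) := by
  have hk : (0 : ℝ) < D.ncard := by
    exact_mod_cast (Set.ncard_pos hD).2 ⟨0, h0⟩
  have hlim : Tendsto (fun n : ℕ => (1 - (M : ℝ) / (2 * n + 1)) / D.ncard) atTop
      (nhds ((1 - 0) / D.ncard)) := by
    refine (tendsto_const_nhds.sub (tendsto_const_nhds.div_atTop ?_)).div_const _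
    exact tendsto_atTop_add_const_right _ _
      (tendsto_natCast_atTop_atTop.const_mul_atTop (by norm_num))
  rw [sub_zero] at hlim
  refine le_upperDensity_of_tendsto hlim fun n => ?_
  have hn : (0 : ℝ) < 2 * n + 1 := by positivity
  have hcount : (2 * n + 1 : ℝ) ≤
      (reflectedGreedy D M ∩ Set.Icc (-(n : ℤ)) (n : ℤ)).ncard * D.ncard + M := by
    exact_mod_cast le_ncard_reflectedGreedy_mul hD h0 hM n
  rw [one_sub_div hn.ne', div_div, div_le_div_iff₀ (by positivity) hn]
  nlinarith [mul_le_mul_of_nonneg_right hcount hn.le]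

theorem stmt9 (S : Set ℤ) (hfin : S.Finite) (hne : S.Nonempty) :
    1 / ((diffSet S).ncard : ℝ) ≤ packingDensity S := by
  have hD := diffSet_finite hfin
  obtain ⟨b, hb⟩ := hD.bddAbove
  have hM : ∀ d ∈ diffSet S, d < ((b.toNat + 1 : ℕ) : ℤ) := fun d hd => by
    have := hb hd
    omega
  exact (one_div_ncard_le_upperDensity_reflectedGreedy hD (zero_mem_diffSet hne)
    b.toNat.succ_pos).trans (upperDensity_le_packingDensity (sPacking_reflectedGreedy hM))
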